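/- Let r ≥ 2, s ≥ 2, d = r + s - 1, and for each q ∈ ℕ let T(q) be the number of tuples (a_1,...,a_r,b_1,...,b_s) ∈ ℤ^{r+s} with 0 ≤ a_i, b_j ≤ q-1 and Σ a_i = Σ b_j. Then lim_{q→∞} T(q)/q^d = (r!/d!)·S(d,r) + (1/d!)·Σ_{0<j<i≤r} C(r,i)·C(s,j)·(-1)^{r-i+j}·(i-j)^d, where S(d,r) is the Stirling number of the second kind. -/

import Mathlib

open Finset Filter

/-- The Stirling number of the second kind `S(n,k)`: the number of partitions of
`{1,...,n}` into `k` (nonempty, pairwise disjoint, covering) blocks. -/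
noncomputable def stirling (n k : ℕ) : ℕ := by
  classical
  exact ((Finset.univ : Finset (Finset (Finset (Fin n)))).filter
    (fun P => P.card = k ∧ (∀ B ∈ P, B.Nonempty) ∧ (∀ x : Fin n, ∃ B ∈ P, x ∈ B) ∧
      (∀ B ∈ P, ∀ C ∈ P, B ≠ C → Disjoint B C))).card

/-- `T r s q` is the number of tuples `(a_1,...,a_r,b_1,...,b_s)` with
`0 ≤ a_i, b_j ≤ q-1` and `Σ a_i = Σ b_j`. -/
noncomputable def equalSumCount (r s q : ℕ) : ℕ := by
  classical
  exact ((Finset.univ : Finset ((Fin r → Fin q) × (Fin s → Fin q))).filter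
    (fun ab => ∑ i, (ab.1 i : ℕ) = ∑ j, (ab.2 j : ℕ))).card


theorem surj_card_fiber (d r : ℕ) (P : Finset (Finset (Fin d))) (hc : P.card = r)
    (hne : ∀ B ∈ P, B.Nonempty) (hcov : ∀ x : Fin d, ∃ B ∈ P, x ∈ B)
    (hdis : ∀ B ∈ P, ∀ C ∈ P, B ≠ C → Disjoint B C) :
    ((univ : Finset (Fin d → Fin r)).filter (fun f => Function.Surjective f ∧
      univ.image (fun i => univ.filter (fun x => f x = i)) = P)).card = r.factorial := by
  classical
  have hcard : Fintype.card (Fin r ≃ P) = r.factorial := by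
    have e : Fin r ≃ P := (Fintype.equivFinOfCardEq (by simp [hc])).symm
    rw [Fintype.card_equiv e, Fintype.card_fin]
  rw [← hcard, ← Finset.card_univ]
  have hP : ∀ f ∈ ((univ : Finset (Fin d → Fin r)).filter (fun f => Function.Surjective f ∧
      univ.image (fun i => univ.filter (fun x => f x = i)) = P)),
      ∀ i, univ.filter (fun x => f x = i) ∈ P := by
    intro f hf i
    have := (mem_filter.1 hf).2.2
    rw [← this]
    exact mem_image_of_mem _ (mem_univ _)
  have hB : ∀ f (hf : f ∈ ((univ : Finset (Fin d → Fin r)).filter (fun f => Function.Surjective f ∧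
      univ.image (fun i => univ.filter (fun x => f x = i)) = P))),
      Function.Bijective (fun i => (⟨_, hP f hf i⟩ : P)) := by
    intro f hf
    obtain ⟨hs, him⟩ := (mem_filter.1 hf).2
    constructor
    · intro i j hij
      obtain ⟨x, hx⟩ := hs i
      have h := congrArg Subtype.val hij
      have : x ∈ univ.filter (fun x => f x = i) := by simp [hx]
      simp only at h
      rw [h] at this
      simp at this
      rw [← hx, this]
    · rintro ⟨B, hB⟩
      rw [← him] at hB
      obtain ⟨i, _, hi⟩ := mem_image.1 hB
      exact ⟨i, Subtype.ext hi⟩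
  refine Finset.card_bij (fun f hf => Equiv.ofBijective _ (hB f hf)) (fun _ _ => mem_univ _) ?_ ?_
  · intro f hf g hg h
    funext x
    have h2 := congrArg (fun e : Fin r ≃ P => (e (f x)).1) h
    simp only [Equiv.ofBijective_apply] at h2
    have : x ∈ univ.filter (fun y => f y = f x) := by simp
    rw [h2] at this
    exact ((mem_filter.1 this).2).symm
  · intro e _
    choose b hb hxb using hcov
    have huniq : ∀ x, ∀ B ∈ P, x ∈ B → b x = B := by
      intro x B hB hx
      by_contra hne
      exact Finset.disjoint_left.1 (hdis _ (hb x) _ hB hne) (hxb x) hx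
    have hfib : ∀ i, univ.filter (fun x => e.symm ⟨b x, hb x⟩ = i) = (e i).1 := by
      intro i
      ext x
      simp only [mem_filter, mem_univ, true_and]
      rw [Equiv.symm_apply_eq]
      constructor
      · intro h
        rw [← h]; exact hxb x
      · intro h
        exact Subtype.ext (huniq x _ (e i).2 h)
    refine ⟨fun x => e.symm ⟨b x, hb x⟩, ?_, ?_⟩
    · simp only [mem_filter, mem_univ, true_and]
      constructor
      · intro i
        obtain ⟨x, hx⟩ := hne _ (e i).2
        rw [← hfib] at hx
        exact ⟨x, by simpa using hx⟩
      · simp only [hfib]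
        ext B
        simp only [mem_image, mem_univ, true_and]
        constructor
        · rintro ⟨i, rfl⟩; exact (e i).2
        · intro h; exact ⟨e.symm ⟨B, h⟩, by simp⟩
    · ext i : 2
      exact hfib i

theorem surj_card (d r : ℕ) :
    ((univ : Finset (Fin d → Fin r)).filter (fun f => Function.Surjective f)).card
      = r.factorial * stirling d r := by
  classical
  unfold stirling
  rw [Finset.card_eq_sum_card_fiberwise (f := fun f : Fin d → Fin r =>
      (univ : Finset (Fin r)).image (fun i => univ.filter (fun x => f x = i)))
    (t := ((Finset.univ : Finset (Finset (Finset (Fin d)))).filter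
    (fun P => P.card = r ∧ (∀ B ∈ P, B.Nonempty) ∧ (∀ x : Fin d, ∃ B ∈ P, x ∈ B) ∧
      (∀ B ∈ P, ∀ C ∈ P, B ≠ C → Disjoint B C))))]
  · rw [Finset.sum_congr rfl (g := fun _ => r.factorial)]
    · rw [Finset.sum_const, smul_eq_mul, mul_comm]
    · intro P hP
      obtain ⟨h1, h2, h3, h4⟩ := (mem_filter.1 hP).2
      rw [← surj_card_fiber d r P h1 h2 h3 h4, Finset.filter_filter]
  · intro f hf
    have hs : Function.Surjective f := by simpa using hf
    simp only [coe_filter, mem_univ, true_and, Set.mem_ofPred_eq]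
    refine ⟨?_, ?_, ?_, ?_⟩
    · rw [Finset.card_image_of_injective, Finset.card_univ, Fintype.card_fin]
      intro i j hij
      obtain ⟨x, hx⟩ := hs i
      have : x ∈ univ.filter (fun x => f x = i) := by simp [hx]
      simp only at hij
      rw [hij] at this
      simp at this
      rw [← hx, this]
    · intro B hB
      obtain ⟨i, _, rfl⟩ := mem_image.1 hB
      obtain ⟨x, hx⟩ := hs i
      exact ⟨x, by simp [hx]⟩
    · intro x
      exact ⟨_, mem_image_of_mem _ (mem_univ (f x)), by simp⟩
    · intro B hB C hC hne
      obtain ⟨i, _, rfl⟩ := mem_image.1 hB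
      obtain ⟨j, _, rfl⟩ := mem_image.1 hC
      rw [Finset.disjoint_left]
      intro x hx hx'
      simp at hx hx'
      exact hne (by rw [← hx, ← hx'])

theorem stirling_formula (d r : ℕ) :
    ((r.factorial : ℝ) * stirling d r) =
      ∑ i ∈ range (r + 1), (r.choose i : ℝ) * (-1) ^ (r - i) * (i : ℝ) ^ d := by
  classical
  have key := Finset.inclusion_exclusion_card_inf_compl (univ : Finset (Fin r))
    (fun i => (univ : Finset (Fin d → Fin r)).filter (fun f => ∀ x, f x ≠ i))
  have h1 : ((univ : Finset (Fin r)).inf fun i =>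
      ((univ : Finset (Fin d → Fin r)).filter (fun f => ∀ x, f x ≠ i))ᶜ)
      = (univ : Finset (Fin d → Fin r)).filter (fun f => Function.Surjective f) := by
    ext f
    rw [Finset.mem_filter]
    simp [Finset.mem_inf, Function.Surjective]
  have h2 : ∀ t : Finset (Fin r), (t.inf fun i =>
      ((univ : Finset (Fin d → Fin r)).filter (fun f => ∀ x, f x ≠ i))).card
      = (r - t.card) ^ d := by
    intro t
    have : (t.inf fun i =>
      ((univ : Finset (Fin d → Fin r)).filter (fun f => ∀ x, f x ≠ i)))
      = Fintype.piFinset (fun _ : Fin d => tᶜ) := by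
      ext f
      simp only [Finset.mem_inf, mem_filter, mem_univ, true_and, Fintype.mem_piFinset, mem_compl]
      constructor
      · intro h x hx
        exact h _ hx x rfl
      · intro h i hi x hx
        exact h x (hx ▸ hi)
    rw [this, Fintype.card_piFinset]
    simp [Finset.card_compl]
  rw [h1, surj_card] at key
  simp only [h2] at key
  rw [Finset.sum_powerset_apply_card (fun k => (-1 : ℤ) ^ k * (((r - k) ^ d : ℕ) : ℤ))] at key
  rw [Finset.card_univ, Fintype.card_fin, ← Finset.sum_range_reflect] at key
  have key' := congrArg (fun z : ℤ => (z : ℝ)) key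
  push_cast at key'
  rw [key']
  refine Finset.sum_congr rfl ?_
  intro i hi
  have hi' : i ≤ r := by simpa [Nat.lt_succ_iff] using hi
  have e2 : r - (r - i) = i := by omega
  rw [e2, Nat.choose_symm hi']
  simp [mul_assoc]

theorem combine (r s d : ℕ) :
    ∑ k ∈ range r, (-1 : ℝ) ^ k * ((r + s).choose k : ℝ) * ((r - k : ℕ) : ℝ) ^ d
    = ∑ i ∈ Icc 1 r, ∑ j ∈ range i, (r.choose i : ℝ) * (s.choose j : ℝ) * (-1 : ℝ) ^ (r - i + j) *
              ((i : ℝ) - (j : ℝ)) ^ d := by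
  simp only [Nat.add_choose_eq, Nat.cast_sum, Finset.mul_sum, Finset.sum_mul]
  rw [Finset.sum_sigma', Finset.sum_sigma']
  refine Finset.sum_nbij' (fun x => ⟨r - x.2.1, x.2.2⟩)
    (fun y => ⟨r - y.1 + y.2, (r - y.1, y.2)⟩) ?_ ?_ ?_ ?_ ?_
  · rintro ⟨k, u, v⟩ h
    simp at h ⊢
    omega
  · rintro ⟨i, j⟩ h
    simp at h ⊢
    omega
  · rintro ⟨k, u, v⟩ h
    simp at h ⊢
    obtain ⟨h, rfl⟩ := h
    have : r - (r - u) = u := by omega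
    simp [this]
  · rintro ⟨i, j⟩ h
    simp at h ⊢
    omega
  · rintro ⟨k, u, v⟩ h
    simp at h ⊢
    obtain ⟨h, rfl⟩ := h
    have e : r - (r - u) = u := by omega
    rw [e, Nat.choose_symm (by omega), Nat.cast_sub (by omega : u + v ≤ r), Nat.cast_sub (by omega : u ≤ r)]
    push_cast
    ring

theorem combine2 (r s d : ℕ) (hd : d ≠ 0) :
    ∑ k ∈ range r, (-1 : ℝ) ^ k * ((r + s).choose k : ℝ) * ((r - k : ℕ) : ℝ) ^ d
    = (r.factorial : ℝ) * stirling d r + ∑ i ∈ Icc 1 r, ∑ j ∈ Ico 1 i,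
       (r.choose i : ℝ) * (s.choose j : ℝ) * (-1 : ℝ) ^ (r - i + j) *
              ((i : ℝ) - (j : ℝ)) ^ d := by
  have h0 : ∑ i ∈ range (r + 1), (r.choose i : ℝ) * (-1) ^ (r - i) * (i : ℝ) ^ d
      = ∑ i ∈ Icc 1 r, (r.choose i : ℝ) * (-1) ^ (r - i) * (i : ℝ) ^ d := by
    symm
    refine Finset.sum_subset ?_ ?_
    · intro i; simp
    · intro i hi hi'
      have : i = 0 := by
        simp at hi hi'; omega
      subst this
      simp [hd]
  rw [combine, stirling_formula, h0, ← Finset.sum_add_distrib]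
  refine Finset.sum_congr rfl fun i hi => ?_
  have hi' : 0 < i := by simp at hi; omega
  rw [Finset.range_eq_Ico, Finset.sum_eq_sum_Ico_succ_bot hi']
  simp

theorem count_coeff (ι : Type) [Fintype ι] [DecidableEq ι] (q m : ℕ) :
    (((univ : Finset (ι → Fin q)).filter (fun x => ∑ i, (x i : ℕ) = m)).card : ℝ)
    = PowerSeries.coeff m ((∑ i ∈ range q, (PowerSeries.X : PowerSeries ℝ) ^ i) ^ (Fintype.card ι)) := by
  rw [← Finset.card_univ, ← Finset.prod_const, ← Fin.sum_univ_eq_sum_range, Finset.prod_univ_sum]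
  simp only [Finset.prod_pow_eq_pow_sum, map_sum, PowerSeries.coeff_X_pow, Fintype.piFinset_univ]
  rw [Finset.sum_boole]
  congr 2
  ext x
  simp [eq_comm]

theorem coeff_formula (q d m : ℕ) :
    PowerSeries.coeff m ((∑ i ∈ range q, (PowerSeries.X : PowerSeries ℝ) ^ i) ^ (d + 1))
    = ∑ k ∈ range (d + 2), (-1 : ℝ) ^ k * ((d + 1).choose k : ℝ) *
        (if q * k ≤ m then ((d + (m - q * k)).choose d : ℝ) else 0) := by
  have h : (∑ i ∈ range q, (PowerSeries.X : PowerSeries ℝ) ^ i) ^ (d + 1)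
      = (1 - PowerSeries.X ^ q) ^ (d + 1) * (PowerSeries.mk fun n => ((d + n).choose d : ℝ)) := by
    rw [← geom_sum_mul_neg, mul_pow, mul_assoc, mul_comm ((1 - PowerSeries.X) ^ (d+1)),
      PowerSeries.mk_add_choose_mul_one_sub_pow_eq_one, mul_one]
  rw [h, sub_eq_neg_add, add_pow, Finset.sum_mul, map_sum]
  refine Finset.sum_congr rfl fun k _ => ?_
  rw [neg_pow, ← pow_mul, one_pow, mul_one]
  have : (-1 : PowerSeries ℝ) ^ k * PowerSeries.X ^ (q * k) * ((d + 1).choose k : PowerSeries ℝ) *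
      (PowerSeries.mk fun n => ((d + n).choose d : ℝ))
      = PowerSeries.C ((-1 : ℝ) ^ k * ((d + 1).choose k : ℝ)) * (PowerSeries.X ^ (q * k) *
      (PowerSeries.mk fun n => ((d + n).choose d : ℝ))) := by
    simp only [map_mul, map_pow, map_neg, map_one, map_natCast]
    ring
  rw [this, PowerSeries.coeff_C_mul, PowerSeries.coeff_X_pow_mul']
  simp

theorem count_eq (r s q : ℕ) :
    equalSumCount r s q = ((univ : Finset (Fin r ⊕ Fin s → Fin q)).filter
      (fun x => ∑ i, (x i : ℕ) = r * (q - 1))).card := by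
  classical
  unfold equalSumCount
  symm
  refine Finset.card_equiv ((Equiv.sumArrowEquivProdArrow (Fin r) (Fin s) (Fin q)).trans
    (Equiv.prodCongr (Equiv.arrowCongr (Equiv.refl _) Fin.revPerm) (Equiv.refl _))) ?_
  intro x
  simp only [mem_filter, mem_univ, true_and, Fintype.sum_sum_type]
  simp [Equiv.sumArrowEquivProdArrow, Equiv.arrowCongr]
  have h : ∑ i : Fin r, (q - ((x (Sum.inl i) : ℕ) + 1)) + ∑ i : Fin r, (x (Sum.inl i) : ℕ)
      = r * (q - 1) := by
    rw [← Finset.sum_add_distrib, Finset.sum_congr rfl (g := fun _ => q - 1)]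
    · simp
    · intro i _
      have := (x (Sum.inl i)).2
      omega
  omega

theorem lim_term (c r d : ℕ) (hc : 0 < c) :
    Tendsto (fun q : ℕ => ((d + (q * c - r)).choose d : ℝ) / (q : ℝ) ^ d) atTop
      (nhds ((c : ℝ) ^ d / d.factorial)) := by
  have hcast : Tendsto (fun q : ℕ => (q : ℝ)) atTop atTop := tendsto_natCast_atTop_atTop
  have hgen : ∀ b : ℝ, Tendsto (fun q : ℕ => (((q : ℝ) * c + b) / q) ^ d / d.factorial) atTop
      (nhds ((c : ℝ) ^ d / d.factorial)) := by
    intro b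
    refine Tendsto.div_const (Tendsto.pow ?_ d) _
    have h1 : Tendsto (fun q : ℕ => (c : ℝ) + b / q) atTop (nhds (c + 0)) :=
      tendsto_const_nhds.add (hcast.const_div_atTop b)
    rw [add_zero] at h1
    refine h1.congr' ?_
    filter_upwards [eventually_gt_atTop 0] with q hq
    have : (q : ℝ) ≠ 0 := by positivity
    field_simp
  refine tendsto_of_tendsto_of_tendsto_of_le_of_le' (hgen (1 - r)) (hgen (d - r)) ?_ ?_
  · filter_upwards [eventually_ge_atTop (r + 1)] with q hq
    have hqc : r ≤ q * c := by nlinarith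
    have h := Nat.pow_sub_le_descFactorial (d + (q * c - r)) d
    rw [Nat.descFactorial_eq_factorial_mul_choose] at h
    have e : d + (q * c - r) + 1 - d = q * c - r + 1 := by omega
    rw [e] at h
    have h' : ((q : ℝ) * c + (1 - r)) ^ d ≤ d.factorial * ((d + (q * c - r)).choose d : ℝ) := by
      have : (((q * c - r + 1 : ℕ) : ℝ)) ^ d ≤ d.factorial * ((d + (q * c - r)).choose d : ℝ) := by
        exact_mod_cast h
      rw [Nat.cast_add, Nat.cast_sub hqc] at this
      push_cast at this
      convert this using 2
      ring
    have hq0 : (0 : ℝ) < q := by exact_mod_cast (by omega : 0 < q)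
    have hf : (0 : ℝ) < d.factorial := by exact_mod_cast d.factorial_pos
    rw [div_pow, div_div, div_le_div_iff₀ (by positivity) (by positivity)]
    have hp : (0 : ℝ) < (q : ℝ) ^ d := by positivity
    nlinarith
  · filter_upwards [eventually_ge_atTop (r + 1)] with q hq
    have hqc : r ≤ q * c := by nlinarith
    have h := Nat.descFactorial_le_pow (d + (q * c - r)) d
    rw [Nat.descFactorial_eq_factorial_mul_choose] at h
    have h' : d.factorial * ((d + (q * c - r)).choose d : ℝ) ≤ ((q : ℝ) * c + (d - r)) ^ d := by
      have : d.factorial * ((d + (q * c - r)).choose d : ℝ) ≤ (((d + (q * c - r) : ℕ) : ℝ)) ^ d := by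
        exact_mod_cast h
      rw [Nat.cast_add, Nat.cast_sub hqc] at this
      push_cast at this
      convert this using 2
      ring
    have hq0 : (0 : ℝ) < q := by exact_mod_cast (by omega : 0 < q)
    have hf : (0 : ℝ) < d.factorial := by exact_mod_cast d.factorial_pos
    rw [div_pow, div_div, div_le_div_iff₀ (by positivity) (by positivity)]
    have hp : (0 : ℝ) < (q : ℝ) ^ d := by positivity
    nlinarith

theorem count_limit (r s d : ℕ) (hr : 0 < r) (hd : r + s = d + 1) :
    Tendsto (fun q : ℕ => (equalSumCount r s q : ℝ) / (q : ℝ) ^ d) atTop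
      (nhds (∑ k ∈ range r, (-1 : ℝ) ^ k * ((r + s).choose k : ℝ) *
        (((r - k : ℕ) : ℝ) ^ d / d.factorial))) := by
  have hmain : Tendsto (fun q : ℕ => ∑ k ∈ range r, (-1 : ℝ) ^ k * ((r + s).choose k : ℝ) *
      (((d + (q * (r - k) - r)).choose d : ℝ) / (q : ℝ) ^ d)) atTop
      (nhds (∑ k ∈ range r, (-1 : ℝ) ^ k * ((r + s).choose k : ℝ) *
        (((r - k : ℕ) : ℝ) ^ d / d.factorial))) := by
    refine tendsto_finsetSum _ fun k hk => ?_
    have : k < r := by simpa using hk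
    exact (lim_term (r - k) r d (by omega)).const_mul _
  refine hmain.congr' ?_
  filter_upwards [eventually_ge_atTop (r + 1)] with q hq
  rw [count_eq, count_coeff, Fintype.card_sum, Fintype.card_fin, Fintype.card_fin, hd,
    coeff_formula, Finset.sum_div]
  have hsub : range r ⊆ range (d + 2) := by
    intro k; simp; omega
  rw [← Finset.sum_subset hsub]
  · refine Finset.sum_congr rfl fun k hk => ?_
    have hk' : k < r := by simpa using hk
    obtain ⟨c, rfl⟩ : ∃ c, r = k + (c + 1) := ⟨r - k - 1, by omega⟩
    obtain ⟨p, rfl⟩ : ∃ p, q = p + 1 := ⟨q - 1, by omega⟩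
    have e : (k + (c + 1)) * (p + 1 - 1) + (k + (c + 1)) = (p + 1) * k + (p + 1) * (c + 1) := by
      simp; ring
    have e1 : k + (c + 1) - k = c + 1 := by omega
    have e0 : k + (c + 1) ≤ (p + 1) * (c + 1) := by nlinarith
    rw [if_pos (by omega), e1, mul_div_assoc]
    congr 5
    omega
  · intro k _ hk
    have hk' : r ≤ k := by simpa using hk
    rw [if_neg]
    · simp
    · have h1 : q * r ≤ q * k := Nat.mul_le_mul_left _ hk'
      obtain ⟨p, rfl⟩ : ∃ p, q = p + 1 := ⟨q - 1, by omega⟩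
      simp only [Nat.add_sub_cancel]
      nlinarith

/-- With `d = r+s-1`,
`lim_{q→∞} T(q)/q^d = (r!/d!)·S(d,r) + (1/d!)·Σ_{0<j<i≤r} C(r,i)C(s,j)(-1)^{r-i+j}(i-j)^d`. -/
theorem equalSumCount_limit (r s d : ℕ) (hr : 2 ≤ r) (hrs : r ≤ s) (hd : d = r + s - 1) :
    Tendsto (fun q : ℕ => (equalSumCount r s q : ℝ) / (q : ℝ) ^ d) atTop
      (nhds (((Nat.factorial r : ℝ) / (Nat.factorial d : ℝ)) * (stirling d r : ℝ) +
        (1 / (Nat.factorial d : ℝ)) *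
          ∑ i ∈ Finset.Icc 1 r, ∑ j ∈ Finset.Ico 1 i,
            (Nat.choose r i : ℝ) * (Nat.choose s j : ℝ) * (-1 : ℝ) ^ (r - i + j) *
              ((i : ℝ) - (j : ℝ)) ^ d)) := by
  have hd' : r + s = d + 1 := by omega
  have h := count_limit r s d (by omega) hd'
  convert h using 2
  have h2 := combine2 r s d (by omega)
  simp only [← mul_div_assoc]
  rw [← Finset.sum_div, h2]
  ring
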